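/- arXiv:dg-ga/9502007 — 2 statements merged into one kernel-verified Lean document; each statement's English description precedes it below -/
import Mathlib

section
/- Let n, m ≥ 1 and Z, Z' ∈ ℂ^{n×m}. Set W = (1 + ZZ^*)^{-1}(1 + ZZ'^*)(1 + Z'Z'^*)^{-1}(1 + Z'Z^*), where * denotes the conjugate transpose of a matrix. Then every eigenvalue λ ∈ ℂ of W (i.e., every element of the spectrum of W) is real and satisfies 0 ≤ λ ≤ 1. -/
open scoped Matrix

noncomputable section

/-- The matrix `W(Z,Z') = (1+ZZ^*)⁻¹(1+ZZ'^*)(1+Z'Z'^*)⁻¹(1+Z'Z^*)` whose eigenvalues are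
the squared cosines of the stationary angles between the `n`-planes `X(Z)` and `X(Z')`. -/
def Wmat (n m : ℕ) (Z Z' : Matrix (Fin n) (Fin m) ℂ) : Matrix (Fin n) (Fin n) ℂ :=
  (1 + Z * Zᴴ)⁻¹ * (1 + Z * Z'ᴴ) * (1 + Z' * Z'ᴴ)⁻¹ * (1 + Z' * Zᴴ)

open scoped ComplexOrder in
/-- Every eigenvalue of `W(Z,Z')` is a real number in `[0,1]`. -/
theorem Wmat_spectrum_real_mem_unit_interval
    (n m : ℕ) (hn : 1 ≤ n) (hm : 1 ≤ m)
    (Z Z' : Matrix (Fin n) (Fin m) ℂ) :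
    ∀ lam ∈ spectrum ℂ (Wmat n m Z Z'), lam.im = 0 ∧ 0 ≤ lam.re ∧ lam.re ≤ 1 := by
  intro lam hlam
  have hA : (1 + Z * Zᴴ).PosDef :=
    Matrix.PosDef.one.add_posSemidef (Matrix.posSemidef_self_mul_conjTranspose Z)
  have hD : (1 + Z' * Z'ᴴ).PosDef :=
    Matrix.PosDef.one.add_posSemidef (Matrix.posSemidef_self_mul_conjTranspose Z')
  have hB : (1 + Z * Z'ᴴ)ᴴ = 1 + Z' * Zᴴ := by simp
  have hM : ((1 + Z * Z'ᴴ) * (1 + Z' * Z'ᴴ)⁻¹ * (1 + Z' * Zᴴ)).PosSemidef := by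
    rw [← hB]
    exact hD.inv.posSemidef.mul_mul_conjTranspose_same _
  have hS : ((1 + Z * Zᴴ) - (1 + Z * Z'ᴴ) * (1 + Z' * Z'ᴴ)⁻¹ * (1 + Z' * Zᴴ)).PosSemidef := by
    rw [← hB]
    have : Invertible (1 + Z' * Z'ᴴ) := hD.isUnit.invertible
    rw [← Matrix.PosDef.fromBlocks₂₂ _ _ hD, hB]
    have h := Matrix.posSemidef_self_mul_conjTranspose (Matrix.fromBlocks (1 : Matrix (Fin n) (Fin n) ℂ) Z
      (1 : Matrix (Fin n) (Fin n) ℂ) Z')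
    simpa [Matrix.fromBlocks_conjTranspose, Matrix.fromBlocks_multiply] using h
  rw [← Matrix.spectrum_toLin', ← Module.End.hasEigenvalue_iff_mem_spectrum] at hlam
  obtain ⟨v, hv⟩ := hlam.exists_hasEigenvector
  have hv0 := hv.2
  have he : Wmat n m Z Z' *ᵥ v = lam • v := by simpa using hv.apply_eq_smul
  have he2 : ((1 + Z * Z'ᴴ) * (1 + Z' * Z'ᴴ)⁻¹ * (1 + Z' * Zᴴ)) *ᵥ v
      = lam • ((1 + Z * Zᴴ) *ᵥ v) := by
    rw [← Matrix.mulVec_smul, ← he, Matrix.mulVec_mulVec, Wmat]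
    congr 1
    simp only [← Matrix.mul_assoc]
    rw [Matrix.mul_nonsing_inv _ ((Matrix.isUnit_iff_isUnit_det _).1 hA.isUnit), Matrix.one_mul]
  have ha := hA.dotProduct_mulVec_pos hv0
  have hb := hM.dotProduct_mulVec_nonneg v
  have hc := hS.dotProduct_mulVec_nonneg v
  rw [Matrix.sub_mulVec, dotProduct_sub, he2, dotProduct_smul, smul_eq_mul] at hc
  rw [he2, dotProduct_smul, smul_eq_mul] at hb
  generalize star v ⬝ᵥ (1 + Z * Zᴴ) *ᵥ v = a at ha hb hc
  have key : ∀ x : ℂ, 0 ≤ x * a → 0 ≤ x := by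
    intro x hx
    rw [Complex.lt_def] at ha
    rw [Complex.le_def] at hx ⊢
    obtain ⟨ha1, ha2⟩ := ha
    obtain ⟨hx1, hx2⟩ := hx
    simp only [Complex.zero_re, Complex.zero_im, Complex.mul_re, Complex.mul_im] at *
    rw [← ha2] at hx1 hx2
    simp only [mul_zero, sub_zero, zero_add] at hx1 hx2
    refine ⟨nonneg_of_mul_nonneg_left hx1 ha1, ?_⟩
    rcases mul_eq_zero.1 hx2.symm with h | h
    · exact h.symm
    · exact absurd h ha1.ne'
  have h0 : 0 ≤ lam := key _ hb
  have h1 : 0 ≤ 1 - lam := by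
    refine key _ ?_
    rwa [sub_mul, one_mul]
  rw [Complex.le_def] at h0 h1
  refine ⟨h0.2.symm, h0.1, ?_⟩
  simpa using h1.1
end
end

section
/- Let n, m ≥ 1 and Z, Z' ∈ ℂ^{n×m}, let W = (1 + ZZ^*)^{-1}(1 + ZZ'^*)(1 + Z'Z'^*)^{-1}(1 + Z'Z^*), and let X(Z), X(Z') be the n-dimensional subspaces of ℂ^{n+m} spanned by the vectors z_i(Z), respectively z_i(Z'). Then 1 belongs to the spectrum of W if and only if X(Z) ∩ X(Z') ≠ {0}. -/
open scoped Matrix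

noncomputable section

/-- The vectors `z_i(Z) = e_i + ∑_j Z_{ij} e_{n+j}`. -/
def zVec (n m : ℕ) (Z : Matrix (Fin n) (Fin m) ℂ) (i : Fin n) :
    EuclideanSpace ℂ (Fin (n + m)) :=
  EuclideanSpace.single (Fin.castAdd m i) 1 +
    ∑ j : Fin m, Z i j • EuclideanSpace.single (Fin.natAdd n j) 1

/-- The `n`-plane `X(Z)` spanned by the `z_i(Z)`. -/
def planeOf (n m : ℕ) (Z : Matrix (Fin n) (Fin m) ℂ) :
    Submodule ℂ (EuclideanSpace ℂ (Fin (n + m))) :=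
  Submodule.span ℂ (Set.range (zVec n m Z))

lemma sum_zVec_castAdd (n m : ℕ) (Z : Matrix (Fin n) (Fin m) ℂ) (a : Fin n → ℂ) (i : Fin n) :
    (∑ k, a k • zVec n m Z k) (Fin.castAdd m i) = a i := by
  have h : ∀ k, (zVec n m Z k) (Fin.castAdd m i) = if i = k then 1 else 0 := by
    intro k
    have h2 : ∀ j : Fin m, Fin.castAdd m i ≠ Fin.natAdd n j := by
      intro j hj
      have := congrArg Fin.val hj
      simp at this
      omega
    simp [zVec, Pi.single_apply, h2]
  simp [h]

lemma sum_zVec_natAdd (n m : ℕ) (Z : Matrix (Fin n) (Fin m) ℂ) (a : Fin n → ℂ) (j : Fin m) :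
    (∑ k, a k • zVec n m Z k) (Fin.natAdd n j) = (a ᵥ* Z) j := by
  have h : ∀ k, (zVec n m Z k) (Fin.natAdd n j) = Z k j := by
    intro k
    have h2 : Fin.natAdd n j ≠ Fin.castAdd m k := by
      intro hj
      have := congrArg Fin.val hj
      simp at this
      omega
    simp [zVec, Pi.single_apply, h2]
  simp [h, Matrix.vecMul, dotProduct]

lemma planes_inter_iff (n m : ℕ) (Z Z' : Matrix (Fin n) (Fin m) ℂ) :
    planeOf n m Z ⊓ planeOf n m Z' ≠ ⊥ ↔ ∃ a : Fin n → ℂ, a ≠ 0 ∧ a ᵥ* Z = a ᵥ* Z' := by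
  rw [Submodule.ne_bot_iff]
  constructor
  · rintro ⟨x, ⟨hx1, hx2⟩, hx0⟩
    obtain ⟨a, rfl⟩ := (Submodule.mem_span_range_iff_exists_fun ℂ).1 hx1
    obtain ⟨b, hb⟩ := (Submodule.mem_span_range_iff_exists_fun ℂ).1 hx2
    have hab : b = a := by
      ext i
      rw [← sum_zVec_castAdd n m Z' b i, hb, sum_zVec_castAdd]
    subst hab
    refine ⟨b, ?_, ?_⟩
    · rintro rfl
      simp at hx0
    · ext j
      rw [← sum_zVec_natAdd, ← sum_zVec_natAdd, hb]
  · rintro ⟨a, ha, h⟩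
    refine ⟨∑ k, a k • zVec n m Z k, ⟨?_, ?_⟩, ?_⟩
    · exact (Submodule.mem_span_range_iff_exists_fun ℂ).2 ⟨a, rfl⟩
    · refine (Submodule.mem_span_range_iff_exists_fun ℂ).2 ⟨a, ?_⟩
      ext k
      refine Fin.addCases (fun i => ?_) (fun j => ?_) k
      · rw [sum_zVec_castAdd, sum_zVec_castAdd]
      · rw [sum_zVec_natAdd, sum_zVec_natAdd, h]
    · intro h0
      apply ha
      ext i
      rw [← sum_zVec_castAdd n m Z a i, h0]
      simp

open scoped ComplexOrder in
lemma isUnit_one_add (n m : ℕ) (Z : Matrix (Fin n) (Fin m) ℂ) : IsUnit (1 + Z * Zᴴ) :=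
  (Matrix.PosDef.one.add_posSemidef (Matrix.posSemidef_self_mul_conjTranspose Z)).isUnit

lemma eq_of_kernel (n m : ℕ) (Z Z' : Matrix (Fin n) (Fin m) ℂ) (a b : Fin n → ℂ)
    (h1 : a ᵥ* (1 + Z * Zᴴ) = b ᵥ* (1 + Z' * Zᴴ))
    (h2 : a ᵥ* (1 + Z * Z'ᴴ) = b ᵥ* (1 + Z' * Z'ᴴ)) :
    a = b ∧ a ᵥ* Z = b ᵥ* Z' := by
  obtain ⟨p, hp⟩ : ∃ p, p = a - b := ⟨_, rfl⟩
  obtain ⟨q, hq⟩ : ∃ q, q = a ᵥ* Z - b ᵥ* Z' := ⟨_, rfl⟩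
  have e1 : p + q ᵥ* Zᴴ = 0 := by
    simp only [Matrix.vecMul_add, Matrix.vecMul_one, ← Matrix.vecMul_vecMul] at h1
    rw [hp, hq, Matrix.sub_vecMul]
    linear_combination (exp := 1) h1
  have e2 : p + q ᵥ* Z'ᴴ = 0 := by
    simp only [Matrix.vecMul_add, Matrix.vecMul_one, ← Matrix.vecMul_vecMul] at h2
    rw [hp, hq, Matrix.sub_vecMul]
    linear_combination (exp := 1) h2
  have f1 : p ⬝ᵥ star a + q ⬝ᵥ (Zᴴ *ᵥ star a) = 0 := by
    rw [Matrix.dotProduct_mulVec, ← add_dotProduct, e1, zero_dotProduct]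
  have f2 : p ⬝ᵥ star b + q ⬝ᵥ (Z'ᴴ *ᵥ star b) = 0 := by
    rw [Matrix.dotProduct_mulVec, ← add_dotProduct, e2, zero_dotProduct]
  have key : p ⬝ᵥ star p + q ⬝ᵥ star q = 0 := by
    have hp' : star p = star a - star b := by rw [hp, star_sub]
    have hq' : star q = Zᴴ *ᵥ star a - Z'ᴴ *ᵥ star b := by
      rw [hq, star_sub, Matrix.star_vecMul, Matrix.star_vecMul]
    rw [hp', hq', dotProduct_sub, dotProduct_sub]
    linear_combination f1 - f2
  open scoped ComplexOrder in
  have hp0 : p = 0 ∧ q = 0 := by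
    have k1 := dotProduct_self_star_nonneg p
    have k2 := dotProduct_self_star_nonneg q
    obtain ⟨r1, r2⟩ := (add_eq_zero_iff_of_nonneg k1 k2).1 key
    exact ⟨dotProduct_self_star_eq_zero.1 r1, dotProduct_self_star_eq_zero.1 r2⟩
  exact ⟨sub_eq_zero.1 (hp ▸ hp0.1), sub_eq_zero.1 (hq ▸ hp0.2)⟩

/-- `1` is an eigenvalue of `W(Z,Z')` iff the `n`-planes `X(Z)` and `X(Z')` intersect
nontrivially. -/
theorem one_mem_spectrum_Wmat_iff_planes_intersect
    (n m : ℕ) (hn : 1 ≤ n) (hm : 1 ≤ m)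
    (Z Z' : Matrix (Fin n) (Fin m) ℂ) :
    (1 : ℂ) ∈ spectrum ℂ (Wmat n m Z Z') ↔ planeOf n m Z ⊓ planeOf n m Z' ≠ ⊥ := by
  rw [planes_inter_iff]
  have hA := (Matrix.isUnit_iff_isUnit_det _).1 (isUnit_one_add n m Z)
  have hC := (Matrix.isUnit_iff_isUnit_det _).1 (isUnit_one_add n m Z')
  have hfac : (1 + Z * Zᴴ) * (1 - Wmat n m Z Z') =
      (1 + Z * Zᴴ) - (1 + Z * Z'ᴴ) * (1 + Z' * Z'ᴴ)⁻¹ * (1 + Z' * Zᴴ) := by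
    rw [Wmat, mul_sub, mul_one, mul_assoc, mul_assoc, Matrix.mul_nonsing_inv_cancel_left _ _ hA,
      mul_assoc]
  have hspec : (1 : ℂ) ∈ spectrum ℂ (Wmat n m Z Z') ↔
      ∃ a : Fin n → ℂ, a ≠ 0 ∧ a ᵥ* ((1 + Z * Zᴴ) -
        (1 + Z * Z'ᴴ) * (1 + Z' * Z'ᴴ)⁻¹ * (1 + Z' * Zᴴ)) = 0 := by
    rw [Matrix.exists_vecMul_eq_zero_iff, ← hfac, Matrix.det_mul, mul_eq_zero,
      or_iff_right hA.ne_zero, spectrum.mem_iff, map_one, Matrix.isUnit_iff_isUnit_det,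
      isUnit_iff_ne_zero, not_not]
  rw [hspec]
  refine exists_congr fun a => and_congr_right fun _ => ?_
  rw [Matrix.vecMul_sub, sub_eq_zero, ← Matrix.vecMul_vecMul]
  constructor
  · intro h
    have := eq_of_kernel n m Z Z' a (a ᵥ* ((1 + Z * Z'ᴴ) * (1 + Z' * Z'ᴴ)⁻¹)) h (by
      rw [Matrix.vecMul_vecMul, Matrix.nonsing_inv_mul_cancel_right _ _ hC])
    rw [← this.1] at this
    exact this.2
  · intro h
    have hB : a ᵥ* (1 + Z * Z'ᴴ) = a ᵥ* (1 + Z' * Z'ᴴ) := by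
      simp only [Matrix.vecMul_add, ← Matrix.vecMul_vecMul, h]
    rw [← Matrix.vecMul_vecMul, hB, Matrix.vecMul_vecMul, Matrix.vecMul_vecMul,
      Matrix.mul_nonsing_inv_cancel_left _ _ hC]
    simp only [Matrix.vecMul_add, Matrix.vecMul_one, ← Matrix.vecMul_vecMul, h]
end
end
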